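/- Let V be a real vector space, let x₁, …, xₙ and y₁, …, yₘ be vectors in V, and let b₁, …, bₙ and d₁, …, dₘ be real numbers. Then there exists a norm N on V such that N(xᵢ) ≤ bᵢ for all 1 ≤ i ≤ n and N(yⱼ) ≥ dⱼ for all 1 ≤ j ≤ m if and only if: (i) bᵢ ≥ 0 for all i; (ii) for all i, if bᵢ = 0 then xᵢ = 0; and (iii) no yⱼ can be written as yⱼ = ∑_{i=1}^n cᵢ·xᵢ with ∑_{i=1}^n |cᵢ|·bᵢ < dⱼ. -/

import Mathlib

/-- `N` is a norm on the real vector space `V`. -/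
def IsNorm {V : Type*} [AddCommGroup V] [Module ℝ V] (N : V → ℝ) : Prop :=
  (∀ v, 0 ≤ N v) ∧ (∀ v, N v = 0 ↔ v = 0) ∧
    (∀ (a : ℝ) v, N (a • v) = |a| * N v) ∧ ∀ v w, N (v + w) ≤ N v + N w

theorem IsNorm.sum_smul_le {V ι : Type*} [AddCommGroup V] [Module ℝ V] {N : V → ℝ}
    (hN : IsNorm N) (s : Finset ι) (c : ι → ℝ) (x : ι → V) :
    N (∑ i ∈ s, c i • x i) ≤ ∑ i ∈ s, |c i| * N (x i) := by
  obtain ⟨-, h0, hsmul, hadd⟩ := hN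
  calc N (∑ i ∈ s, c i • x i) ≤ ∑ i ∈ s, N (c i • x i) :=
        Finset.le_sum_of_subadditive N ((h0 0).2 rfl).le hadd s _
    _ = _ := by simp only [hsmul]

/-- Every real vector space carries a norm: the `ℓ¹` norm with respect to a basis. -/
theorem exists_isNorm (V : Type*) [AddCommGroup V] [Module ℝ V] : ∃ N : V → ℝ, IsNorm N := by
  let e := Module.Basis.ofVectorSpace ℝ V
  have hs (v : V) : Summable fun i => |e.repr v i| :=
    summable_of_ne_finset_zero (s := (e.repr v).support) fun i hi => by simpa using hi
  refine ⟨fun v => ∑' i, |e.repr v i|, fun v => tsum_nonneg fun i => abs_nonneg _,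
    fun v => ⟨fun h => ?_, ?_⟩, fun a v => ?_, fun v w => ?_⟩
  · have h0 := (hs v).hasSum
    rw [show ∑' i, |e.repr v i| = 0 from h, hasSum_zero_iff_of_nonneg fun i => abs_nonneg _] at h0
    apply e.repr.map_eq_zero_iff.1
    ext i
    simpa using congrFun h0 i
  · rintro rfl
    simp
  · simp [abs_mul, tsum_mul_left]
  · rw [← (hs v).tsum_add (hs w)]
    refine (hs _).tsum_le_tsum (fun i => ?_) ((hs v).add (hs w))
    simpa using abs_add_le (e.repr v i) (e.repr w i)

/-- The least cost of writing `w` as a combination of the vectors `x i`, when using `x i` with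
coefficient `c` costs `|c| * b i`. -/
noncomputable def combinationCost {V ι : Type*} [Fintype ι] [AddCommGroup V] [Module ℝ V]
    (x : ι → V) (b : ι → ℝ) (w : V) : ℝ :=
  sInf ((fun c : ι → ℝ => ∑ i, |c i| * b i) '' {c | ∑ i, c i • x i = w})

section combinationCost

variable {V ι : Type*} [Fintype ι] [AddCommGroup V] [Module ℝ V] {x : ι → V} {b : ι → ℝ}

theorem combinationCost_nonneg (hb : ∀ i, 0 ≤ b i) (w : V) : 0 ≤ combinationCost x b w := by
  apply Real.sInf_nonneg
  rintro _ ⟨c, -, rfl⟩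
  exact Finset.sum_nonneg fun i _ => mul_nonneg (abs_nonneg _) (hb i)

theorem combinationCost_sum_le (hb : ∀ i, 0 ≤ b i) (c : ι → ℝ) :
    combinationCost x b (∑ i, c i • x i) ≤ ∑ i, |c i| * b i := by
  refine csInf_le ⟨0, ?_⟩ ⟨c, rfl, rfl⟩
  rintro _ ⟨c, -, rfl⟩
  exact Finset.sum_nonneg fun i _ => mul_nonneg (abs_nonneg _) (hb i)

theorem le_combinationCost {w : V} (hw : w ∈ Submodule.span ℝ (Set.range x)) {t : ℝ}
    (h : ∀ c : ι → ℝ, ∑ i, c i • x i = w → t ≤ ∑ i, |c i| * b i) :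
    t ≤ combinationCost x b w := by
  obtain ⟨c, hc⟩ := (Submodule.mem_span_range_iff_exists_fun ℝ).1 hw
  refine le_csInf ⟨_, c, hc, rfl⟩ ?_
  rintro _ ⟨c, hc, rfl⟩
  exact h c hc

theorem combinationCost_zero (hb : ∀ i, 0 ≤ b i) : combinationCost x b 0 = 0 :=
  le_antisymm (by simpa using combinationCost_sum_le (x := x) hb 0) (combinationCost_nonneg hb 0)

theorem combinationCost_add_le (hb : ∀ i, 0 ≤ b i) {v w : V}
    (hv : v ∈ Submodule.span ℝ (Set.range x)) (hw : w ∈ Submodule.span ℝ (Set.range x)) :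
    combinationCost x b (v + w) ≤ combinationCost x b v + combinationCost x b w := by
  rw [← sub_le_iff_le_add']
  refine le_combinationCost hw fun c hc => ?_
  rw [sub_le_comm]
  refine le_combinationCost hv fun a ha => ?_
  rw [sub_le_iff_le_add, ← hc, ← ha, ← Finset.sum_add_distrib, ← Finset.sum_add_distrib]
  simp only [← add_smul, ← add_mul]
  refine (combinationCost_sum_le hb _).trans (Finset.sum_le_sum fun i _ => ?_)
  exact mul_le_mul_of_nonneg_right (abs_add_le _ _) (hb i)

theorem combinationCost_smul_le (hb : ∀ i, 0 ≤ b i) {a : ℝ} (ha : a ≠ 0) {v : V}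
    (hv : v ∈ Submodule.span ℝ (Set.range x)) :
    combinationCost x b (a • v) ≤ |a| * combinationCost x b v := by
  rw [← div_le_iff₀' (abs_pos.2 ha)]
  refine le_combinationCost hv fun c hc => ?_
  rw [div_le_iff₀' (abs_pos.2 ha), ← hc, Finset.smul_sum, Finset.mul_sum]
  simpa only [smul_smul, abs_mul, mul_assoc] using
    combinationCost_sum_le (x := x) hb fun i => a * c i

theorem combinationCost_smul (hb : ∀ i, 0 ≤ b i) (a : ℝ) {v : V}
    (hv : v ∈ Submodule.span ℝ (Set.range x)) :
    combinationCost x b (a • v) = |a| * combinationCost x b v := by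
  rcases eq_or_ne a 0 with rfl | ha
  · simp [combinationCost_zero hb]
  refine le_antisymm (combinationCost_smul_le hb ha hv) ?_
  have h := combinationCost_smul_le hb (inv_ne_zero ha) (Submodule.smul_mem _ a hv)
  rwa [inv_smul_smul₀ ha, abs_inv, ← div_eq_inv_mul, le_div_iff₀' (abs_pos.2 ha)] at h

theorem eq_zero_of_combinationCost_eq_zero (hb : ∀ i, 0 ≤ b i) (hx : ∀ i, b i = 0 → x i = 0)
    {v : V} (hv : v ∈ Submodule.span ℝ (Set.range x)) (h : combinationCost x b v = 0) :
    v = 0 := by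
  obtain ⟨ν, hν⟩ := exists_isNorm V
  have hnn : ∀ i, 0 ≤ ν (x i) / b i := fun i => div_nonneg (hν.1 _) (hb i)
  set C : ℝ := 1 + ∑ i, ν (x i) / b i with hC
  have hC0 : 0 < C := add_pos_of_pos_of_nonneg one_pos (Finset.sum_nonneg fun i _ => hnn i)
  have hxC : ∀ i, ν (x i) ≤ C * b i := fun i => by
    rcases (hb i).eq_or_lt with h0 | h0
    · rw [hx i h0.symm, (hν.2.1 0).2 rfl, ← h0, mul_zero]
    · rw [← div_le_iff₀ h0]
      have := Finset.single_le_sum (fun i _ => hnn i) (Finset.mem_univ i)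
      linarith
  have key : ν v / C ≤ combinationCost x b v := le_combinationCost hv fun c hc => by
    rw [div_le_iff₀' hC0, ← hc, Finset.mul_sum]
    refine (hν.sum_smul_le _ _ _).trans (Finset.sum_le_sum fun i _ => ?_)
    rw [mul_left_comm]
    exact mul_le_mul_of_nonneg_left (hxC i) (abs_nonneg _)
  rw [h, div_le_iff₀ hC0, zero_mul] at key
  exact (hν.2.1 v).1 (le_antisymm key (hν.1 v))

end combinationCost

theorem stmt_15 {V : Type*} [AddCommGroup V] [Module ℝ V]
    (n m : ℕ) (x : Fin n → V) (y : Fin m → V) (b : Fin n → ℝ) (d : Fin m → ℝ) :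
    (∃ N : V → ℝ, IsNorm N ∧ (∀ i, N (x i) ≤ b i) ∧ ∀ j, d j ≤ N (y j)) ↔
      ((∀ i, 0 ≤ b i) ∧ (∀ i, b i = 0 → x i = 0) ∧
        ¬ ∃ (j : Fin m) (c : Fin n → ℝ), (∑ i, |c i| * b i) < d j ∧ y j = ∑ i, c i • x i) := by
  constructor
  · rintro ⟨N, hN, hx, hy⟩
    refine ⟨fun i => (hN.1 _).trans (hx i), fun i hi => (hN.2.1 _).1
      (le_antisymm (hi ▸ hx i) (hN.1 _)), ?_⟩
    rintro ⟨j, c, hlt, hj⟩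
    refine (hlt.trans_le (hy j)).not_ge ?_
    rw [hj]
    exact (hN.sum_smul_le _ _ _).trans
      (Finset.sum_le_sum fun i _ => mul_le_mul_of_nonneg_left (hx i) (abs_nonneg _))
  · rintro ⟨hb, hx, hy⟩
    obtain ⟨ν, hν⟩ := exists_isNorm V
    obtain ⟨ν_nonneg, ν_zero, ν_smul, ν_add⟩ := hν
    set W := Submodule.span ℝ (Set.range x) with hW
    obtain ⟨g, hg⟩ := W.subtype.exists_leftInverse_of_injective W.ker_subtype
    have hgW : ∀ v ∈ W, (g v : V) = v := fun v hv =>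
      congrArg Subtype.val (LinearMap.congr_fun hg ⟨v, hv⟩)
    have hxW : ∀ i, x i ∈ W := fun i => Submodule.subset_span ⟨i, rfl⟩
    have hnn : ∀ j, 0 ≤ |d j| / ν (y j - g (y j)) := fun j =>
      div_nonneg (abs_nonneg _) (ν_nonneg _)
    set K : ℝ := 1 + ∑ j, |d j| / ν (y j - g (y j)) with hK
    have hK0 : 0 < K := add_pos_of_pos_of_nonneg one_pos (Finset.sum_nonneg fun j _ => hnn j)
    have hKν : ∀ v, 0 ≤ K * ν v := fun v => mul_nonneg hK0.le (ν_nonneg v)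
    have hcost : ∀ v, 0 ≤ combinationCost x b v := combinationCost_nonneg hb
    refine ⟨fun v => combinationCost x b (g v) + K * ν (v - g v),
      ⟨fun v => add_nonneg (hcost _) (hKν _), fun v => ⟨fun h => ?_, ?_⟩, fun a v => ?_,
        fun v w => ?_⟩, fun i => ?_, fun j => ?_⟩
    · obtain ⟨h1, h2⟩ := (add_eq_zero_iff_of_nonneg (hcost _) (hKν _)).1 h
      have h3 := (ν_zero _).1 ((mul_eq_zero.1 h2).resolve_left hK0.ne')
      rw [sub_eq_zero.1 h3]
      exact eq_zero_of_combinationCost_eq_zero hb hx (g v).2 h1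
    · rintro rfl
      simp [combinationCost_zero hb, (ν_zero 0).2 rfl]
    · simp only [map_smul, Submodule.coe_smul, ← smul_sub, ν_smul,
        combinationCost_smul hb a (g v).2]
      ring
    · have h1 := combinationCost_add_le hb (g v).2 (g w).2
      have h2 := mul_le_mul_of_nonneg_left (ν_add (v - g v) (w - g w)) hK0.le
      simp only [map_add, Submodule.coe_add, add_sub_add_comm]
      linarith
    · simp only [hgW _ (hxW i), sub_self, (ν_zero 0).2 rfl, mul_zero, add_zero]
      classical
      simpa [Pi.single_apply, ite_smul, apply_ite abs, ite_mul] using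
        combinationCost_sum_le (x := x) hb (Pi.single i 1)
    · by_cases hj : y j ∈ W
      · simp only [hgW _ hj, sub_self, (ν_zero 0).2 rfl, mul_zero, add_zero]
        exact le_combinationCost hj fun c hc => not_lt.1 fun hlt => hy ⟨j, c, hlt, hc.symm⟩
      · have hpos : 0 < ν (y j - g (y j)) := (ν_nonneg _).lt_of_ne' fun h =>
          hj (sub_eq_zero.1 ((ν_zero _).1 h) ▸ (g (y j)).2)
        have hle : |d j| / ν (y j - g (y j)) ≤ K := by
          have := Finset.single_le_sum (fun j _ => hnn j) (Finset.mem_univ j)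
          linarith
        rw [div_le_iff₀ hpos] at hle
        linarith [le_abs_self (d j), hcost (g (y j))]
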